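/- arXiv:1711.03629 — 4 statements merged into one kernel-verified Lean document; each statement's English description precedes it below -/
import Mathlib

section
/- Let S₁ and S₂ be topological spaces, let T₁ ⊆ S₁ and T₂ ⊆ S₂ be closed subsets, and let γ : [0,1] → S₁ × S₂ be a continuous path such that γ(t) ∉ T₁ × T₂ for all t ∈ [0,1]. Then there exist n ∈ ℕ and a partition 0 = t₀ ≤ t₁ ≤ ⋯ ≤ tₙ = 1 such that for each k ∈ {1, …, n}, either the first coordinate of γ avoids T₁ on all of [t₍k₋₁₎, t_k], or the second coordinate of γ avoids T₂ on all of [t₍k₋₁₎, t_k]. -/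
open Set unitInterval

/-- If `γ : [0,1] → S₁ × S₂` is a continuous path avoiding `T₁ × T₂` (with `T₁`, `T₂` closed),
then `[0,1]` can be partitioned as `0 = t₀ ≤ t₁ ≤ ⋯ ≤ tₙ = 1` so that on each subinterval
`[tₖ₋₁, tₖ]` either the first coordinate of `γ` avoids `T₁` or the second coordinate of `γ`
avoids `T₂`. -/
theorem exists_partition_coord_avoiding {S₁ S₂ : Type*}
    [TopologicalSpace S₁] [TopologicalSpace S₂]
    (T₁ : Set S₁) (T₂ : Set S₂) (hT₁ : IsClosed T₁) (hT₂ : IsClosed T₂)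
    (γ : C(I, S₁ × S₂)) (hγ : ∀ t : I, γ t ∉ T₁ ×ˢ T₂) :
    ∃ (n : ℕ) (t : Fin (n + 1) → I), Monotone t ∧ t 0 = 0 ∧ t (Fin.last n) = 1 ∧
      ∀ k : Fin n,
        (∀ s ∈ Icc (t k.castSucc) (t k.succ), (γ s).1 ∉ T₁) ∨
        (∀ s ∈ Icc (t k.castSucc) (t k.succ), (γ s).2 ∉ T₂) := by
  let c : Bool → Set I := fun b =>
    if b then {s | (γ s).1 ∉ T₁} else {s | (γ s).2 ∉ T₂}
  have h1 : IsOpen {s : I | (γ s).1 ∉ T₁} :=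
    hT₁.isOpen_compl.preimage (continuous_fst.comp γ.continuous)
  have h2 : IsOpen {s : I | (γ s).2 ∉ T₂} :=
    hT₂.isOpen_compl.preimage (continuous_snd.comp γ.continuous)
  have hc₁ : ∀ b, IsOpen (c b) := by
    intro b
    cases b
    · simpa [c] using h2
    · simpa [c] using h1
  have hc₂ : (univ : Set I) ⊆ ⋃ b, c b := by
    intro s _
    rw [mem_iUnion]
    by_cases h : (γ s).1 ∈ T₁
    · exact ⟨false, fun h' => hγ s ⟨h, h'⟩⟩
    · exact ⟨true, h⟩
  obtain ⟨t, ht0, htm, ⟨n, hn⟩, ht⟩ :=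
    exists_monotone_Icc_subset_open_cover_unitInterval hc₁ hc₂
  refine ⟨n, fun k => t k, fun a b hab => htm hab, ht0, hn n le_rfl, fun k => ?_⟩
  obtain ⟨b, hb⟩ := ht k
  cases b
  · exact Or.inr fun s hs => hb hs
  · exact Or.inl fun s hs => hb hs
end

section
/- Let S₁ and S₂ be topological spaces, let T₁ ⊆ S₁ and T₂ ⊆ S₂ be closed subsets such that S₁ ∖ T₁ and S₂ ∖ T₂ are path-connected, and let s₁ ∈ S₁ ∖ T₁, s₂ ∈ S₂ ∖ T₂. Let W = (S₁ × S₂) ∖ (T₁ × T₂) with basepoint w = (s₁, s₂). Then every loop in W based at w is path-homotopic in W (rel endpoints) to a finite concatenation of loops based at w, each of which has image contained in (S₁ ∖ T₁) × S₂ or has image contained in S₁ × (S₂ ∖ T₂). (Note both of these sets are contained in W.) -/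
open Set

/-- The concatenation of a finite list of loops based at `x`. -/
noncomputable def loopConcat {X : Type*} [TopologicalSpace X] {x : X} : List (Path x x) → Path x x
  | [] => Path.refl x
  | p :: l => p.trans (loopConcat l)

namespace LoopAux

variable {X : Type*} [TopologicalSpace X] {w : X}

/-- `γ` is homotopic to a concatenation of loops each in `U` or in `V`. -/
def Good (U V : Set X) (γ : Path w w) : Prop :=
  ∃ l : List (Path w w), (∀ p ∈ l, range p ⊆ U ∨ range p ⊆ V) ∧ Path.Homotopic γ (loopConcat l)

lemma good_of_homotopic {U V : Set X} {γ γ' : Path w w} (h : Path.Homotopic γ γ')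
    (g : Good U V γ') : Good U V γ := by
  obtain ⟨l, hl, hh⟩ := g
  exact ⟨l, hl, h.trans hh⟩

lemma good_of_range {U V : Set X} {γ : Path w w} (h : range γ ⊆ U ∨ range γ ⊆ V) :
    Good U V γ := by
  refine ⟨[γ], by simpa using h, ?_⟩
  exact (Path.Homotopic.trans_refl γ).symm

lemma loopConcat_append (l m : List (Path w w)) :
    Path.Homotopic (loopConcat (l ++ m)) ((loopConcat l).trans (loopConcat m)) := by
  induction l with
  | nil => exact (Path.Homotopic.refl_trans _).symm
  | cons p l ih =>
    exact ((Path.Homotopic.refl p).hcomp ih).trans (Path.Homotopic.trans_assoc _ _ _).symm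

lemma good_trans {U V : Set X} {γ γ' : Path w w} (g : Good U V γ) (g' : Good U V γ') :
    Good U V (γ.trans γ') := by
  obtain ⟨l, hl, hh⟩ := g
  obtain ⟨m, hm, hh'⟩ := g'
  refine ⟨l ++ m, ?_, (hh.hcomp hh').trans (loopConcat_append l m).symm⟩
  intro p hp
  rcases List.mem_append.1 hp with hp | hp
  · exact hl p hp
  · exact hm p hp

/-- The initial part of a path. -/
def head {w' : X} (γ : Path w w') (t : unitInterval) : Path w (γ t) :=
  (γ.subpath 0 t).cast γ.source.symm rfl

lemma head_step {w' : X} (γ : Path w w') (s t : unitInterval) :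
    Path.Homotopic (head γ t) ((head γ s).trans (γ.subpath s t)) :=
  (Path.Homotopic.pathCast ⟨Path.Homotopy.subpathTransSubpath γ 0 s t⟩ γ.source.symm rfl).symm

lemma regroup {x y : X} (h : Path w y) (a : Path w x) (d : Path w x) (s : Path x y)
    (e : Path w y) (hh : Path.Homotopic h (a.trans s)) :
    Path.Homotopic (h.trans e.symm) ((a.trans d.symm).trans ((d.trans s).trans e.symm)) := by
  rw [← Path.Homotopic.Quotient.eq] at hh ⊢
  simp only [Path.Homotopic.Quotient.mk_trans, Path.Homotopic.Quotient.mk_symm] at hh ⊢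
  rw [hh]
  simp only [Path.Homotopic.Quotient.trans_assoc]
  rw [← Path.Homotopic.Quotient.trans_assoc (Path.Homotopic.Quotient.symm _)]
  simp

lemma good_main {U V : Set X} (hU : IsOpen U) (hV : IsOpen V) (hUV : ∀ x, x ∈ U ∨ x ∈ V)
    (γ : Path w w)
    (hδ : ∀ t, ∃ δ : Path w (γ t), (γ t ∈ U → range δ ⊆ U) ∧ (γ t ∈ V → range δ ⊆ V)) :
    Good U V γ := by
  choose δ hδU hδV using hδ
  obtain ⟨t, ht0, htm, ⟨n, hn⟩, hc⟩ := exists_monotone_Icc_subset_open_cover_unitInterval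
    (c := fun b : Bool => γ ⁻¹' (if b then U else V))
    (by
      intro b
      cases b
      · simpa using hV.preimage γ.continuous
      · simpa using hU.preimage γ.continuous)
    (by
      intro s _
      rcases hUV (γ s) with h | h
      · exact mem_iUnion.2 ⟨true, by simpa using h⟩
      · exact mem_iUnion.2 ⟨false, by simpa using h⟩)
  have key : ∀ k, Good U V ((head γ (t k)).trans (δ (t k)).symm) := by
    intro k
    induction k with
    | zero =>
      rw [ht0]
      apply good_of_range
      have hr : range (head γ 0) = {γ 0} := by
        have : ⇑(head γ 0) = fun _ => γ 0 := by
          have h := Path.subpath_self γ 0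
          rw [head, h]
          rfl
        rw [this, range_const]
      rw [Path.trans_range, Path.symm_range, hr]
      rcases hUV (γ 0) with h | h
      · exact Or.inl (union_subset (by simpa using h) (hδU 0 h))
      · exact Or.inr (union_subset (by simpa using h) (hδV 0 h))
    | succ k ih =>
      refine good_of_homotopic (regroup _ _ (δ (t k)) _ _ (head_step γ (t k) (t (k+1)))) ?_
      refine good_trans ih (good_of_range ?_)
      have hle := htm (Nat.le_succ k)
      rw [Path.trans_range, Path.trans_range, Path.symm_range,
        Path.range_subpath_of_le _ _ _ hle]
      obtain ⟨b, hb⟩ := hc k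
      cases b
      · right
        have hb : Icc (t k) (t (k+1)) ⊆ γ ⁻¹' V := by simpa using hb
        exact union_subset (union_subset (hδV _ (hb ⟨le_rfl, hle⟩)) (image_subset_iff.2 hb))
          (hδV _ (hb ⟨hle, le_rfl⟩))
      · left
        have hb : Icc (t k) (t (k+1)) ⊆ γ ⁻¹' U := by simpa using hb
        exact union_subset (union_subset (hδU _ (hb ⟨le_rfl, hle⟩)) (image_subset_iff.2 hb))
          (hδU _ (hb ⟨hle, le_rfl⟩))
  have h1 := key n
  rw [hn n le_rfl] at h1
  have h2 : Good U V ((δ 1).cast rfl γ.target.symm) := by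
    apply good_of_range
    rcases hUV (γ 1) with h | h
    · exact Or.inl (hδU 1 h)
    · exact Or.inr (hδV 1 h)
  refine good_of_homotopic ?_ (good_trans h1 h2)
  have e1 : (head γ 1).cast rfl γ.target.symm = γ := by
    ext s
    simp [head]
  have e2 : (head γ 1).trans (δ 1).symm =
      ((head γ 1).cast rfl γ.target.symm).trans ((δ 1).cast rfl γ.target.symm).symm := by
    ext s
    rfl
  rw [e2, e1]
  generalize (δ 1).cast rfl γ.target.symm = d
  rw [← Path.Homotopic.Quotient.eq]
  simp [Path.Homotopic.Quotient.mk_trans, Path.Homotopic.Quotient.mk_symm,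
    Path.Homotopic.Quotient.trans_assoc]

/-- A connecting path in one factor. -/
lemma exists_conn {S : Type*} [TopologicalSpace S] {T : Set S} (hpc : IsPathConnected Tᶜ)
    {s x : S} (hs : s ∉ T) (hj : Joined s x) :
    ∃ d : Path s x, x ∉ T → ∀ t, d t ∉ T := by
  by_cases hx : x ∈ T
  · exact ⟨hj.somePath, fun h => absurd hx h⟩
  · have h := hpc.joinedIn s hs x hx
    exact ⟨h.somePath, fun _ t => h.somePath_mem t⟩

end LoopAux

/-- Let `T₁ ⊆ S₁`, `T₂ ⊆ S₂` be closed sets with path-connected complements, and let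
`W = (S₁ × S₂) ∖ (T₁ × T₂)` with basepoint `w = (s₁, s₂)` where `s₁ ∉ T₁`, `s₂ ∉ T₂`.
Then every loop in `W` based at `w` is path-homotopic in `W` to a finite concatenation of
loops based at `w`, each of whose image is contained in `(S₁ ∖ T₁) × S₂` or in
`S₁ × (S₂ ∖ T₂)`. -/
theorem loop_homotopic_concat_of_coord_loops {S₁ S₂ : Type*}
    [TopologicalSpace S₁] [TopologicalSpace S₂]
    {T₁ : Set S₁} {T₂ : Set S₂} (hT₁ : IsClosed T₁) (hT₂ : IsClosed T₂)
    (hpc₁ : IsPathConnected T₁ᶜ) (hpc₂ : IsPathConnected T₂ᶜ)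
    {s₁ : S₁} {s₂ : S₂} (hs₁ : s₁ ∉ T₁) (hs₂ : s₂ ∉ T₂)
    (w : {p : S₁ × S₂ // p ∉ T₁ ×ˢ T₂}) (hw : (w : S₁ × S₂) = (s₁, s₂))
    (γ : Path w w) :
    ∃ l : List (Path w w),
      (∀ p ∈ l,
        (∀ t : unitInterval, ((p t : S₁ × S₂)).1 ∉ T₁) ∨
        (∀ t : unitInterval, ((p t : S₁ × S₂)).2 ∉ T₂)) ∧
      Path.Homotopic γ (loopConcat l) := by
  have hw1 : (w : S₁ × S₂).1 ∉ T₁ := by rw [hw]; exact hs₁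
  have hw2 : (w : S₁ × S₂).2 ∉ T₂ := by rw [hw]; exact hs₂
  have c1 : Continuous fun q : {p : S₁ × S₂ // p ∉ T₁ ×ˢ T₂} => (q : S₁ × S₂).1 := by fun_prop
  have c2 : Continuous fun q : {p : S₁ × S₂ // p ∉ T₁ ×ˢ T₂} => (q : S₁ × S₂).2 := by fun_prop
  have main := LoopAux.good_main (w := w)
    (U := {q | (q : S₁ × S₂).1 ∉ T₁}) (V := {q | (q : S₁ × S₂).2 ∉ T₂})
    (hT₁.isOpen_compl.preimage c1) (hT₂.isOpen_compl.preimage c2)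
    (by
      rintro ⟨q, hq⟩
      simp only [mem_prod, not_and_or] at hq
      exact hq) γ
    (by
      intro t
      have hh := LoopAux.head γ t
      obtain ⟨d1, h1⟩ := LoopAux.exists_conn hpc₁ hw1 ⟨hh.map c1⟩
      obtain ⟨d2, h2⟩ := LoopAux.exists_conn hpc₂ hw2 ⟨hh.map c2⟩
      have hmem : ∀ s, (d1 s, d2 s) ∉ T₁ ×ˢ T₂ := by
        intro s hs
        have hq := (γ t).2
        simp only [mem_prod, not_and_or] at hq
        rcases hq with hq | hq
        · exact h1 hq s hs.1
        · exact h2 hq s hs.2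
      refine ⟨⟨⟨fun s => ⟨(d1 s, d2 s), hmem s⟩, by fun_prop⟩, ?_, ?_⟩, ?_, ?_⟩
      · apply Subtype.ext
        simp
      · apply Subtype.ext
        simp
      · rintro hq _ ⟨s, rfl⟩
        exact h1 hq s
      · rintro hq _ ⟨s, rfl⟩
        exact h2 hq s)
  obtain ⟨l, hl, hh⟩ := main
  refine ⟨l, fun p hp => ?_, hh⟩
  rcases hl p hp with h | h
  · exact Or.inl fun t => h (mem_range_self t)
  · exact Or.inr fun t => h (mem_range_self t)
end

section
/- Let f : ℝ → ℝ be differentiable on the open interval (0,1) and convex on (0,1], with f(x) = 0 for all x ∈ [1/2, 1], f(x) ≥ 0 for all x ∈ (0,1], and f integrable on (0,1]. Then the function x ↦ x·√(1 + (f′(x))²) is integrable on (0,1]; equivalently, the area 2π·∫₀¹ x·√(1 + (f′(x))²) dx of the surface of revolution obtained by rotating the graph of f around the y-axis is finite. -/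
open Set MeasureTheory

/-- The funnel obtained by rotating the graph of `f` around the `y`-axis has finite area:
if `f` is differentiable on `(0,1)`, convex on `(0,1]`, vanishes on `[1/2, 1]`, is non-negative
on `(0,1]` and integrable on `(0,1]`, then `x ↦ x * √(1 + f'(x)²)` is integrable on `(0,1]`. -/
theorem integrableOn_mul_sqrt_one_add_deriv_sq (f : ℝ → ℝ)
    (hdiff : DifferentiableOn ℝ f (Ioo (0:ℝ) 1))
    (hconv : ConvexOn ℝ (Ioc (0:ℝ) 1) f)
    (hzero : ∀ x ∈ Icc (1/2 : ℝ) 1, f x = 0)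
    (hnonneg : ∀ x ∈ Ioc (0:ℝ) 1, 0 ≤ f x)
    (hint : IntegrableOn f (Ioc (0:ℝ) 1)) :
    IntegrableOn (fun x => x * Real.sqrt (1 + (deriv f x) ^ 2)) (Ioc (0:ℝ) 1) := by
  have hg : Integrable (fun x => indicator (Ioc (0:ℝ) 1) f (x / 2)) :=
    ((integrable_indicator_iff measurableSet_Ioc).2 hint).comp_div (by norm_num)
  rw [integrableOn_Ioc_iff_integrableOn_Ioo]
  have hb : IntegrableOn (fun x => 1 + 2 * indicator (Ioc (0:ℝ) 1) f (x / 2)) (Ioo (0:ℝ) 1) := by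
    have h1 : IntegrableOn (fun _ : ℝ => (1:ℝ)) (Ioo (0:ℝ) 1) :=
      integrableOn_const (by simp)
    exact h1.add (hg.const_mul 2).integrableOn
  refine Integrable.mono' hb ?_ ?_
  · have := measurable_deriv f
    exact (by fun_prop : Measurable
      (fun x => x * Real.sqrt (1 + (deriv f x) ^ 2))).aestronglyMeasurable
  · refine (ae_restrict_iff' measurableSet_Ioo).2 (Filter.Eventually.of_forall fun x hx => ?_)
    obtain ⟨hx0, hx1⟩ := hx
    have hmx : x ∈ Ioc (0:ℝ) 1 := ⟨hx0, hx1.le⟩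
    have hmh : x / 2 ∈ Ioc (0:ℝ) 1 := ⟨by linarith, by linarith⟩
    have hd : DifferentiableAt ℝ f x := hdiff.differentiableAt (Ioo_mem_nhds hx0 hx1)
    have hl := hconv.slope_le_deriv hmh hmx (by linarith) hd
    have hu := hconv.deriv_le_slope hmx (right_mem_Ioc.2 one_pos) hx1 hd
    have hfx := hnonneg x hmx
    have hf1 : f 1 = 0 := hzero 1 ⟨by norm_num, le_rfl⟩
    rw [slope_def_field] at hl hu
    rw [div_le_iff₀ (by linarith)] at hl
    rw [le_div_iff₀ (by linarith), hf1] at hu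
    have hneg : deriv f x ≤ 0 := by
      by_contra hc
      have := mul_pos (not_le.1 hc) (by linarith : 0 < 1 - x)
      linarith
    have hs : Real.sqrt (1 + (deriv f x) ^ 2) ≤ 1 - deriv f x :=
      Real.sqrt_le_iff.2 ⟨by linarith, by nlinarith⟩
    rw [Real.norm_of_nonneg (by positivity), indicator_of_mem hmh]
    have := mul_le_mul_of_nonneg_left hs hx0.le
    nlinarith
end

section
/- Let 𝕋⁴ = (ℝ/ℤ)⁴ with the product (sup) metric, where ℝ/ℤ carries its quotient metric, and for t ∈ ℝ let [t] denote its class in ℝ/ℤ. Define the subsets X¹ = {p : p₁=[0] ∧ p₂=[0]} ∪ {p : p₃=[0] ∧ p₄=[0]}, X² = {p : p₁=[1/3] ∧ p₃=[1/3]} ∪ {p : p₂=[1/3] ∧ p₄=[1/3]}, and X³ = {p : p₁=[2/3] ∧ p₄=[2/3]} ∪ {p : p₂=[2/3] ∧ p₃=[2/3]} of 𝕋⁴. Then for any two distinct indices i, j ∈ {1,2,3} and any points p ∈ Xⁱ and q ∈ Xʲ, one has dist(p, q) ≥ 1/3. In particular X¹, X², X³ are pairwise disjoint. -/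
open Set

/-- The flat 4-torus `(ℝ/ℤ)⁴` with the sup metric. -/
abbrev T4 : Type := Fin 4 → AddCircle (1 : ℝ)

/-- `X¹ = {t₁ = 0, t₂ = 0} ∪ {t₃ = 0, t₄ = 0}`. -/
def X1 : Set T4 :=
  {p | p 0 = ((0 : ℝ) : AddCircle (1 : ℝ)) ∧ p 1 = ((0 : ℝ) : AddCircle (1 : ℝ))} ∪
  {p | p 2 = ((0 : ℝ) : AddCircle (1 : ℝ)) ∧ p 3 = ((0 : ℝ) : AddCircle (1 : ℝ))}

/-- `X² = {t₁ = 1/3, t₃ = 1/3} ∪ {t₂ = 1/3, t₄ = 1/3}`. -/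
def X2 : Set T4 :=
  {p | p 0 = ((1/3 : ℝ) : AddCircle (1 : ℝ)) ∧ p 2 = ((1/3 : ℝ) : AddCircle (1 : ℝ))} ∪
  {p | p 1 = ((1/3 : ℝ) : AddCircle (1 : ℝ)) ∧ p 3 = ((1/3 : ℝ) : AddCircle (1 : ℝ))}

/-- `X³ = {t₁ = 2/3, t₄ = 2/3} ∪ {t₂ = 2/3, t₃ = 2/3}`. -/
def X3 : Set T4 :=
  {p | p 0 = ((2/3 : ℝ) : AddCircle (1 : ℝ)) ∧ p 3 = ((2/3 : ℝ) : AddCircle (1 : ℝ))} ∪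
  {p | p 1 = ((2/3 : ℝ) : AddCircle (1 : ℝ)) ∧ p 2 = ((2/3 : ℝ) : AddCircle (1 : ℝ))}

/-- Real numbers whose difference lies between `1/3` and `2/3` in absolute value have classes
at distance at least `1/3`. -/
lemma circle_dist_ge (a b : ℝ) (h1 : 1/3 ≤ |a - b|) (h2 : |a - b| ≤ 2/3) :
    (1/3 : ℝ) ≤ dist (a : AddCircle (1 : ℝ)) (b : AddCircle (1 : ℝ)) := by
  rw [dist_eq_norm, ← AddCircle.coe_sub, UnitAddCircle.norm_eq]
  generalize a - b = x at *
  generalize round x = n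
  obtain ⟨h3, h4⟩ := abs_le.mp h2
  rcases lt_trichotomy n 0 with h | h | h
  · have h' : (n : ℝ) ≤ -1 := by exact_mod_cast (by omega : n ≤ -1)
    exact le_trans (by linarith) (le_abs_self _)
  · subst h
    simpa using h1
  · have h' : (1 : ℝ) ≤ n := by exact_mod_cast h
    exact le_trans (by linarith) (neg_le_abs _)

/-- The sup distance is at least the distance of any common coordinate. -/
lemma torus_dist_ge (p q : T4) (k : Fin 4) (a b : ℝ)
    (hp : p k = (a : AddCircle (1 : ℝ))) (hq : q k = (b : AddCircle (1 : ℝ)))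
    (h1 : 1/3 ≤ |a - b|) (h2 : |a - b| ≤ 2/3) : (1/3 : ℝ) ≤ dist p q := by
  refine le_trans ?_ (dist_le_pi_dist p q k)
  rw [hp, hq]
  exact circle_dist_ge a b h1 h2

lemma dist_X1_X2 (p q : T4) (hp : p ∈ X1) (hq : q ∈ X2) : (1/3 : ℝ) ≤ dist p q := by
  have h1 : (1/3 : ℝ) ≤ |0 - 1/3| := by norm_num [abs_of_pos, abs_of_neg]
  have h2 : |(0 : ℝ) - 1/3| ≤ 2/3 := by norm_num [abs_of_pos, abs_of_neg]
  rcases hp with ⟨ha, hb⟩ | ⟨ha, hb⟩ <;> rcases hq with ⟨hc, hd⟩ | ⟨hc, hd⟩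
  · exact torus_dist_ge p q 0 _ _ ha hc h1 h2
  · exact torus_dist_ge p q 1 _ _ hb hc h1 h2
  · exact torus_dist_ge p q 2 _ _ ha hd h1 h2
  · exact torus_dist_ge p q 3 _ _ hb hd h1 h2

lemma dist_X1_X3 (p q : T4) (hp : p ∈ X1) (hq : q ∈ X3) : (1/3 : ℝ) ≤ dist p q := by
  have h1 : (1/3 : ℝ) ≤ |0 - 2/3| := by norm_num [abs_of_pos, abs_of_neg]
  have h2 : |(0 : ℝ) - 2/3| ≤ 2/3 := by norm_num [abs_of_pos, abs_of_neg]
  rcases hp with ⟨ha, hb⟩ | ⟨ha, hb⟩ <;> rcases hq with ⟨hc, hd⟩ | ⟨hc, hd⟩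
  · exact torus_dist_ge p q 0 _ _ ha hc h1 h2
  · exact torus_dist_ge p q 1 _ _ hb hc h1 h2
  · exact torus_dist_ge p q 3 _ _ hb hd h1 h2
  · exact torus_dist_ge p q 2 _ _ ha hd h1 h2

lemma dist_X2_X3 (p q : T4) (hp : p ∈ X2) (hq : q ∈ X3) : (1/3 : ℝ) ≤ dist p q := by
  have h1 : (1/3 : ℝ) ≤ |1/3 - 2/3| := by norm_num [abs_of_pos, abs_of_neg]
  have h2 : |(1/3 : ℝ) - 2/3| ≤ 2/3 := by norm_num [abs_of_pos, abs_of_neg]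
  rcases hp with ⟨ha, hb⟩ | ⟨ha, hb⟩ <;> rcases hq with ⟨hc, hd⟩ | ⟨hc, hd⟩
  · exact torus_dist_ge p q 0 _ _ ha hc h1 h2
  · exact torus_dist_ge p q 2 _ _ hb hd h1 h2
  · exact torus_dist_ge p q 3 _ _ hb hd h1 h2
  · exact torus_dist_ge p q 1 _ _ ha hc h1 h2

/-- Any two points in distinct members of `{X¹, X², X³}` are at distance at least `1/3`;
in particular, `X¹`, `X²`, `X³` are pairwise disjoint. -/
theorem dist_ge_third_of_mem_ne :
    (∀ i j : Fin 3, i ≠ j → ∀ p ∈ ![X1, X2, X3] i, ∀ q ∈ ![X1, X2, X3] j,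
      (1/3 : ℝ) ≤ dist p q) ∧
    (∀ i j : Fin 3, i ≠ j → Disjoint (![X1, X2, X3] i) (![X1, X2, X3] j)) := by
  have key : ∀ i j : Fin 3, i ≠ j → ∀ p ∈ ![X1, X2, X3] i, ∀ q ∈ ![X1, X2, X3] j,
      (1/3 : ℝ) ≤ dist p q := by
    intro i j hij p hp q hq
    fin_cases i <;> fin_cases j
    · exact absurd rfl hij
    · exact dist_X1_X2 p q hp hq
    · exact dist_X1_X3 p q hp hq
    · exact dist_comm p q ▸ dist_X1_X2 q p hq hp
    · exact absurd rfl hij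
    · exact dist_X2_X3 p q hp hq
    · exact dist_comm p q ▸ dist_X1_X3 q p hq hp
    · exact dist_comm p q ▸ dist_X2_X3 q p hq hp
    · exact absurd rfl hij
  refine ⟨key, fun i j hij => Set.disjoint_left.mpr fun p hp hq => ?_⟩
  have h := key i j hij p hp p hq
  rw [dist_self] at h
  norm_num at h
end
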